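/- arXiv:2406.05971 — 7 statements merged into one kernel-verified Lean document; each statement's English description precedes it below -/
import Mathlib

section
/- Let I ⊂ ℝ be an open interval containing 0 and γ : I → ℝ³ a C^∞ map with γ'(0) = 0 and γ''(0) ≠ 0 (a generalized space-cusp at 0). Then there exist ε > 0, a C^∞ function t : (−ε,ε) → I with t(0) = 0 and t'(u) > 0 for all u ∈ (−ε,ε), and a C^∞ map ξ̂ : (−ε,ε) → ℝ³ with ‖ξ̂(u)‖ = 1 for all u, such that the reparametrized curve γ̂ := γ ∘ t satisfies γ̂'(u) = u·ξ̂(u) for all u ∈ (−ε,ε). -/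
open Matrix

open Filter Topology
open scoped ContDiff

/-- A function that is smooth on an open neighbourhood of a point has the same germ there as a
globally smooth function. -/
theorem exists_contDiff_eventuallyEq {E : Type*} [NormedAddCommGroup E] [NormedSpace ℝ E]
    {p : ℝ → E} {s : Set ℝ} {x₀ : ℝ} (hs : IsOpen s) (hx₀ : x₀ ∈ s) (hp : ContDiffOn ℝ ∞ p s) :
    ∃ P : ℝ → E, ContDiff ℝ ∞ P ∧ P =ᶠ[𝓝 x₀] p := by
  obtain ⟨r, hr, hrs⟩ := Metric.isOpen_iff.1 hs x₀ hx₀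
  let χ : ContDiffBump x₀ := ⟨r / 4, r / 2, by positivity, by linarith⟩
  have hχs : tsupport χ ⊆ s := by
    rw [χ.tsupport_eq]
    exact (Metric.closedBall_subset_ball (half_lt_self hr)).trans hrs
  refine ⟨fun x => χ x • p x, contDiff_iff_contDiffAt.2 fun x => ?_, ?_⟩
  · by_cases hx : x ∈ tsupport χ
    · exact χ.contDiff.contDiffAt.smul (hp.contDiffAt (hs.mem_nhds (hχs hx)))
    · refine contDiffAt_const (c := (0 : E)) |>.congr_of_eventuallyEq ?_
      filter_upwards [notMem_tsupport_iff_eventuallyEq.1 hx] with y hy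
      simp [hy]
  · filter_upwards [χ.eventuallyEq_one] with y hy
    simp [hy]

/-- Differentiation under the integral sign for weighted averages of `g` along the segment from
`0` to `x`. -/
theorem hasDerivAt_integral_pow_smul_comp_mul {E : Type*} [NormedAddCommGroup E]
    [NormedSpace ℝ E] {g : ℝ → E} (hg : ContDiff ℝ ∞ g) (k : ℕ) (x₀ : ℝ) :
    HasDerivAt (fun x => ∫ s in (0 : ℝ)..1, s ^ k • g (x * s))
      (∫ s in (0 : ℝ)..1, s ^ (k + 1) • deriv g (x₀ * s)) x₀ := by
  have hg' : Continuous (deriv g) := (contDiff_infty_iff_deriv.1 hg).2.continuous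
  have hgc : Continuous g := hg.continuous
  obtain ⟨C, hC⟩ := ((isCompact_Icc (a := x₀ - 1) (b := x₀ + 1)).prod
    (isCompact_Icc (a := (0 : ℝ)) (b := 1))).exists_bound_of_continuousOn
    (f := fun z : ℝ × ℝ => z.2 ^ (k + 1) • deriv g (z.1 * z.2))
    (by fun_prop)
  refine (intervalIntegral.hasDerivAt_integral_of_dominated_loc_of_deriv_le
    (F' := fun x s => s ^ (k + 1) • deriv g (x * s)) (bound := fun _ => C)
    (Icc_mem_nhds (sub_one_lt x₀) (lt_add_one x₀)) ?_ ?_ ?_ ?_ ?_ ?_).2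
  · exact .of_forall fun x => Continuous.aestronglyMeasurable (by fun_prop)
  · exact Continuous.intervalIntegrable (by fun_prop) _ _
  · exact Continuous.aestronglyMeasurable (by fun_prop)
  · refine .of_forall fun s hs x hx => hC (x, s) ⟨hx, ?_⟩
    rw [Set.uIoc_of_le zero_le_one] at hs
    exact ⟨hs.1.le, hs.2⟩
  · exact intervalIntegrable_const
  · refine .of_forall fun s _ x _ => ?_
    have h := ((hg.differentiable (by simp) (x * s)).hasDerivAt.scomp x
      (hasDerivAt_mul_const s)).const_smul (s ^ k)
    rw [smul_smul, ← pow_succ] at h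
    exact h

theorem contDiff_integral_pow_smul_comp_mul {E : Type*} [NormedAddCommGroup E]
    [NormedSpace ℝ E] {g : ℝ → E} (hg : ContDiff ℝ ∞ g) (k : ℕ) :
    ContDiff ℝ ∞ fun x => ∫ s in (0 : ℝ)..1, s ^ k • g (x * s) := by
  refine contDiff_infty.2 fun n => ?_
  induction n generalizing g k with
  | zero =>
    exact contDiff_zero.2 (continuous_iff_continuousAt.2 fun x =>
      (hasDerivAt_integral_pow_smul_comp_mul hg k x).continuousAt)
  | succ n ih =>
    rw [Nat.cast_add_one, contDiff_succ_iff_deriv]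
    refine ⟨fun x => (hasDerivAt_integral_pow_smul_comp_mul hg k x).differentiableAt,
      by simp, ?_⟩
    rw [funext fun x => (hasDerivAt_integral_pow_smul_comp_mul hg k x).deriv]
    exact ih (contDiff_infty_iff_deriv.1 hg).2 (k + 1)

/-- Hadamard's lemma: a smooth function of one variable vanishing at `0` is divisible by the
variable, with smooth quotient. -/
theorem exists_contDiff_eq_smul {E : Type*} [NormedAddCommGroup E] [NormedSpace ℝ E]
    [CompleteSpace E] {f : ℝ → E} (hf : ContDiff ℝ ∞ f) (h0 : f 0 = 0) :
    ∃ h : ℝ → E, ContDiff ℝ ∞ h ∧ h 0 = deriv f 0 ∧ ∀ x, f x = x • h x := by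
  have hf' := (contDiff_infty_iff_deriv.1 hf).2
  refine ⟨_, contDiff_integral_pow_smul_comp_mul hf' 0, by simp, fun x => ?_⟩
  simp only [pow_zero, one_smul]
  rw [intervalIntegral.smul_integral_comp_mul_left, intervalIntegral.integral_deriv_eq_sub
    (fun y _ => hf.differentiable (by simp) y) (hf'.continuous.intervalIntegrable _ _)]
  simp [h0]

/-- For smooth `ρ`, the primitive of `x * ρ x` vanishing at `0` is
`x ^ 2 * m x` for a smooth `m`. -/
theorem exists_contDiff_hasDerivAt_sq_mul {ρ : ℝ → ℝ} (hρ : ContDiff ℝ ∞ ρ) :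
    ∃ m : ℝ → ℝ, ContDiff ℝ ∞ m ∧ m 0 = ρ 0 / 2 ∧
      ∀ x, HasDerivAt (fun x => x ^ 2 * m x) (x * ρ x) x := by
  refine ⟨_, contDiff_integral_pow_smul_comp_mul hρ 1, ?_, fun x => ?_⟩
  · simp [div_eq_mul_inv, mul_comm]
  · have hc : Continuous fun y => y * ρ y := continuous_id.mul hρ.continuous
    refine (intervalIntegral.integral_hasDerivAt_right (hc.intervalIntegrable 0 x)
      (hc.stronglyMeasurableAtFilter _ _) hc.continuousAt).congr_of_eventuallyEq
      (.of_forall fun y => ?_)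
    have h := intervalIntegral.smul_integral_comp_mul_left (a := 0) (b := 1)
      (fun z => z * ρ z) y
    rw [mul_zero, mul_one] at h
    simp only
    rw [← h, smul_eq_mul, pow_two, mul_assoc, ← intervalIntegral.integral_const_mul]
    congr 2
    ext s
    simp only [pow_one, smul_eq_mul]
    ring

/-- If `ρ` is smooth and `ρ 0 > 0`, there is near `0` a smooth function `φ` with `φ 0 = 0`,
`φ' > 0` and `φ φ' = x ρ`. -/
theorem exists_contDiffAt_mul_deriv_eq {ρ : ℝ → ℝ} (hρ : ContDiff ℝ ∞ ρ) (h0 : 0 < ρ 0) :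
    ∃ φ d : ℝ → ℝ, φ 0 = 0 ∧ ∀ᶠ x in 𝓝 0, ContDiffAt ℝ ∞ φ x ∧ HasDerivAt φ (d x) x ∧
      0 < d x ∧ φ x * d x = x * ρ x := by
  obtain ⟨m, hm, hm0, hmd⟩ := exists_contDiff_hasDerivAt_sq_mul hρ
  have hmc : Continuous m := hm.continuous
  have hm' : Continuous (deriv m) := (contDiff_infty_iff_deriv.1 hm).2.continuous
  have hm_pos : 0 < m 0 := by rw [hm0]; positivity
  refine ⟨fun x => x * √(2 * m x), fun x => √(2 * m x) + x * (deriv m x / √(2 * m x)),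
    by simp, ?_⟩
  have hd : ContinuousAt (fun x => √(2 * m x) + x * (deriv m x / √(2 * m x))) 0 := by
    fun_prop (disch := positivity)
  filter_upwards [hmc.continuousAt.eventually_const_lt hm_pos,
    hd.eventually_const_lt (u := 0) (by simpa using hm_pos)] with x hx hdx
  have hmx : HasDerivAt m (deriv m x) x := (hm.differentiable (by simp) x).hasDerivAt
  have hs : 0 < √(2 * m x) := by positivity
  have hsq : √(2 * m x) ^ 2 = 2 * m x := Real.sq_sqrt (by positivity)
  refine ⟨?_, ?_, hdx, ?_⟩
  · exact contDiffAt_id.mul ((contDiff_const.mul hm).contDiffAt.sqrt (by positivity))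
  · refine ((hasDerivAt_id x).mul ((hmx.const_mul 2).sqrt (by positivity))).congr_deriv ?_
    rw [id, one_mul, mul_div_mul_left _ _ two_ne_zero]
  · have h := (hmd x).unique ((hasDerivAt_pow 2 x).mul hmx)
    rw [h]
    field_simp
    rw [hsq]
    push_cast
    ring

/-- Normalized parametrization of a generalized space-cusp: if `γ` is smooth on an open
interval `(a,b)` containing `0` with `γ'(0) = 0` and `γ''(0) ≠ 0`, then there are `ε > 0`,
a smooth reparametrizing map `t` with `t 0 = 0` and `t' > 0`, and a smooth unit vector field
`ξ̂` (Euclidean norm 1, i.e. `ξ̂ ⬝ᵥ ξ̂ = 1`) with `(γ ∘ t)'(u) = u • ξ̂ u` on `(-ε,ε)`. -/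
theorem stmt2 (a b : ℝ) (ha : a < 0) (hb : 0 < b)
    (γ : ℝ → (Fin 3 → ℝ))
    (hγ : ContDiffOn ℝ (⊤ : ℕ∞) γ (Set.Ioo a b))
    (h1 : deriv γ 0 = 0)
    (h2 : deriv (deriv γ) 0 ≠ 0) :
    ∃ ε > (0 : ℝ), ∃ t : ℝ → ℝ, ∃ ξ : ℝ → (Fin 3 → ℝ),
      ContDiffOn ℝ (⊤ : ℕ∞) t (Set.Ioo (-ε) ε) ∧
      t 0 = 0 ∧
      (∀ u ∈ Set.Ioo (-ε) ε, t u ∈ Set.Ioo a b) ∧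
      (∀ u ∈ Set.Ioo (-ε) ε, 0 < deriv t u) ∧
      ContDiffOn ℝ (⊤ : ℕ∞) ξ (Set.Ioo (-ε) ε) ∧
      (∀ u ∈ Set.Ioo (-ε) ε, ξ u ⬝ᵥ ξ u = 1) ∧
      (∀ u ∈ Set.Ioo (-ε) ε, deriv (γ ∘ t) u = u • ξ u) := by
  have hI : Set.Ioo a b ∈ 𝓝 (0 : ℝ) := Ioo_mem_nhds ha hb
  obtain ⟨f, hf, hfγ⟩ := exists_contDiff_eventuallyEq isOpen_Ioo ⟨ha, hb⟩
    (hγ.deriv_of_isOpen (m := ∞) isOpen_Ioo (by simp))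
  obtain ⟨h, hh, hh0, hfh⟩ := exists_contDiff_eq_smul hf (hfγ.eq_of_nhds.trans h1)
  rw [hfγ.deriv_eq] at hh0
  have hq : ContDiff ℝ ∞ fun x => h x ⬝ᵥ h x := by
    have hc := contDiff_pi.1 hh
    exact ContDiff.sum fun i _ => (hc i).mul (hc i)
  have hq0 : 0 < h 0 ⬝ᵥ h 0 := by
    rw [hh0]
    simpa using dotProduct_star_self_pos_iff.2 h2
  obtain ⟨ρ, hρ, hρq⟩ := exists_contDiff_eventuallyEq
    (p := fun x => √(h x ⬝ᵥ h x)) (isOpen_lt continuous_const hq.continuous) hq0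
    fun x hx => (hq.contDiffAt.sqrt (ne_of_gt hx)).contDiffWithinAt
  obtain ⟨φ, d, hφ0, hφ⟩ := exists_contDiffAt_mul_deriv_eq hρ
    (by rw [hρq.eq_of_nhds]; positivity)
  have hφ₀ := hφ.self_of_nhds
  let e := hφ₀.1.toOpenPartialHomeomorph φ (hφ₀.2.1.hasFDerivAt_equiv hφ₀.2.2.1.ne') (by simp)
  have h0e : (0 : ℝ) ∈ e.source := hφ₀.1.mem_toOpenPartialHomeomorph_source _ _
  have he : ∀ x, e x = φ x := fun _ => rfl
  have h0t : (0 : ℝ) ∈ e.target := by simpa [he, hφ0] using e.map_source h0e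
  have hs0 : e.symm 0 = 0 := by simpa [he, hφ0] using e.left_inv h0e
  have hgood : ∀ᶠ x in 𝓝 (e.symm 0), x ∈ Set.Ioo a b ∧ f x = deriv γ x ∧
      ρ x = √(h x ⬝ᵥ h x) ∧ 0 < h x ⬝ᵥ h x ∧ ContDiffAt ℝ ∞ φ x ∧ HasDerivAt φ (d x) x ∧
      0 < d x ∧ φ x * d x = x * ρ x := by
    rw [hs0]
    filter_upwards [hI, hfγ, hρq, hq.continuous.continuousAt.eventually_const_lt hq0, hφ]
      with x h₁ h₂ h₃ h₄ h₅ using ⟨h₁, h₂, h₃, h₄, h₅⟩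
  obtain ⟨ε, hε, hball⟩ := Metric.eventually_nhds_iff_ball.1
    (((e.continuousAt_symm h0t).eventually hgood).and (e.open_target.mem_nhds h0t))
  rw [Real.ball_eq_Ioo, zero_sub, zero_add] at hball
  have htd : ∀ u ∈ Set.Ioo (-ε) ε, HasDerivAt e.symm (d (e.symm u))⁻¹ u := fun u hu => by
    obtain ⟨⟨-, -, -, -, -, hd, hpos, -⟩, hut⟩ := hball u hu
    exact e.hasDerivAt_symm hut hpos.ne' hd
  have hts : ∀ u ∈ Set.Ioo (-ε) ε, ContDiffAt ℝ ∞ e.symm u := fun u hu => by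
    obtain ⟨⟨-, -, -, -, hsm, hd, hpos, -⟩, hut⟩ := hball u hu
    exact e.contDiffAt_symm_deriv hpos.ne' hut hd hsm
  refine ⟨ε, hε, e.symm, fun u => (√(h (e.symm u) ⬝ᵥ h (e.symm u)))⁻¹ • h (e.symm u),
    fun u hu => (hts u hu).contDiffWithinAt, hs0, fun u hu => (hball u hu).1.1,
    fun u hu => ?_, fun u hu => ?_, fun u hu => ?_, fun u hu => ?_⟩
  · rw [(htd u hu).deriv]
    exact inv_pos.2 (hball u hu).1.2.2.2.2.2.2.1
  · have hpos := (hball u hu).1.2.2.2.1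
    exact ((((hq.contDiffAt.sqrt hpos.ne').inv (Real.sqrt_pos.2 hpos).ne').smul
      hh.contDiffAt).comp u (hts u hu)).contDiffWithinAt
  · have hpos := (hball u hu).1.2.2.2.1
    rw [smul_dotProduct, dotProduct_smul, smul_smul, smul_eq_mul, ← mul_inv,
      Real.mul_self_sqrt hpos.le, inv_mul_cancel₀ hpos.ne']
  · obtain ⟨⟨hmem, hfx, hρx, hpos, -, -, hd, hφd⟩, hut⟩ := hball u hu
    have hγx : HasDerivAt γ (deriv γ (e.symm u)) (e.symm u) :=
      ((hγ.contDiffAt (isOpen_Ioo.mem_nhds hmem)).differentiableAt (by simp)).hasDerivAt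
    rw [(hγx.scomp u (htd u hu)).deriv, ← hfx, hfh, smul_smul, smul_smul]
    have hφu : φ (e.symm u) = u := e.right_inv hut
    rw [hφu, hρx] at hφd
    congr 1
    have := Real.sqrt_pos.2 hpos
    field_simp
    linarith
end

section
/- Let ξ : I → ℝ³ be C^∞ on an open interval I containing 0, let γ : I → ℝ³ satisfy γ'(u) = u·ξ(u), let b : U → ℝ³ be C^∞ on an open neighborhood U of (0,0) ∈ ℝ² with I × {0} meeting U, and define f(u,v) := γ(u) + v·ξ(u) + v²·b(u,v). Then f_u(u,0) = u·ξ(u) and f_v(u,0) = ξ(u) for all u, hence (f_u × f_v)(u,0) = 0 for all u (every point of the u-axis is a singular point of f). Moreover, if ξ(0) × ξ'(0) ≠ 0, then there is a neighborhood V ⊂ U of (0,0) on which (f_u × f_v)(u,v) = 0 holds if and only if v = 0. -/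
/-- Partial derivative in the first variable of a map `ℝ × ℝ → ℝ³`. -/
noncomputable def pd1v (F : ℝ × ℝ → (Fin 3 → ℝ)) (p : ℝ × ℝ) : Fin 3 → ℝ :=
  fderiv ℝ F p (1, 0)

/-- Partial derivative in the second variable of a map `ℝ × ℝ → ℝ³`. -/
noncomputable def pd2v (F : ℝ × ℝ → (Fin 3 → ℝ)) (p : ℝ × ℝ) : Fin 3 → ℝ :=
  fderiv ℝ F p (0, 1)

/-- The cross product on `ℝ³` is jointly continuous. -/
theorem continuous_crossProduct_uncurry :
    Continuous fun q : (Fin 3 → ℝ) × (Fin 3 → ℝ) => crossProduct q.1 q.2 := by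
  refine continuous_pi fun i => ?_
  fin_cases i <;> simp only [cross_apply] <;> simp <;> fun_prop

/-- The partial derivatives of `(u, v) ↦ γ(u) + v ξ(u) + v² B(u, v)`. -/
theorem partials_developable_add_sq {ξ γ : ℝ → (Fin 3 → ℝ)} {B : ℝ × ℝ → (Fin 3 → ℝ)}
    {p : ℝ × ℝ} (hξ : DifferentiableAt ℝ ξ p.1) (hγ : DifferentiableAt ℝ γ p.1)
    (hB : DifferentiableAt ℝ B p) :
    pd1v (fun q => γ q.1 + q.2 • ξ q.1 + q.2 ^ 2 • B q) p =
        deriv γ p.1 + p.2 • deriv ξ p.1 + p.2 ^ 2 • pd1v B p ∧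
      pd2v (fun q => γ q.1 + q.2 • ξ q.1 + q.2 ^ 2 • B q) p =
        ξ p.1 + (2 * p.2) • B p + p.2 ^ 2 • pd2v B p := by
  have h1 := hγ.hasDerivAt.hasFDerivAt.comp p (hasFDerivAt_fst (𝕜 := ℝ) (p := p))
  have h2 := hξ.hasDerivAt.hasFDerivAt.comp p (hasFDerivAt_fst (𝕜 := ℝ) (p := p))
  have h3 := hasFDerivAt_snd (𝕜 := ℝ) (p := p)
  have h := ((h1.add (h3.smul h2)).add ((h3.pow 2).smul hB.hasFDerivAt)).fderiv
  have hF : fderiv ℝ (fun q : ℝ × ℝ => γ q.1 + q.2 • ξ q.1 + q.2 ^ 2 • B q) p = _ := h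
  constructor
  · rw [pd1v, hF]
    simp [pd1v]
  · rw [pd2v, hF]
    simp [pd2v]
    abel

/-- For `f(u,v) = γ(u) + v ξ(u) + v² b(u,v)` with `γ'(u) = u ξ(u)`:
`f_u(u,0) = u ξ(u)`, `f_v(u,0) = ξ(u)`, hence `(f_u × f_v)(u,0) = 0`; and if
`ξ(0) × ξ'(0) ≠ 0`, there is a neighborhood `V` of the origin on which
`(f_u × f_v)(u,v) = 0 ↔ v = 0`. -/
theorem stmt5 (a b : ℝ) (ha : a < 0) (hb : 0 < b)
    (U : Set (ℝ × ℝ)) (hU : IsOpen U) (hO : ((0 : ℝ), (0 : ℝ)) ∈ U)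
    (ξ γ : ℝ → (Fin 3 → ℝ)) (B : ℝ × ℝ → (Fin 3 → ℝ))
    (hξ : ContDiffOn ℝ (⊤ : ℕ∞) ξ (Set.Ioo a b))
    (hγ : ContDiffOn ℝ (⊤ : ℕ∞) γ (Set.Ioo a b))
    (hγ' : ∀ u ∈ Set.Ioo a b, deriv γ u = u • ξ u)
    (hB : ContDiffOn ℝ (⊤ : ℕ∞) B U)
    (f : ℝ × ℝ → (Fin 3 → ℝ))
    (hf : ∀ p : ℝ × ℝ, f p = γ p.1 + p.2 • ξ p.1 + p.2 ^ 2 • B p) :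
    (∀ u ∈ Set.Ioo a b, (u, (0 : ℝ)) ∈ U → pd1v f (u, 0) = u • ξ u) ∧
    (∀ u ∈ Set.Ioo a b, (u, (0 : ℝ)) ∈ U → pd2v f (u, 0) = ξ u) ∧
    (∀ u ∈ Set.Ioo a b, (u, (0 : ℝ)) ∈ U →
      crossProduct (pd1v f (u, 0)) (pd2v f (u, 0)) = 0) ∧
    (crossProduct (ξ 0) (deriv ξ 0) ≠ 0 →
      ∃ V : Set (ℝ × ℝ), IsOpen V ∧ ((0 : ℝ), (0 : ℝ)) ∈ V ∧ V ⊆ U ∧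
        (∀ p ∈ V, p.1 ∈ Set.Ioo a b) ∧
        ∀ p ∈ V, (crossProduct (pd1v f p) (pd2v f p) = 0 ↔ p.2 = 0)) := by
  have hI : IsOpen (Set.Ioo a b) := isOpen_Ioo
  have hpd : ∀ p ∈ U, p.1 ∈ Set.Ioo a b →
      pd1v f p = p.1 • ξ p.1 + p.2 • deriv ξ p.1 + p.2 ^ 2 • pd1v B p ∧
      pd2v f p = ξ p.1 + (2 * p.2) • B p + p.2 ^ 2 • pd2v B p := by
    intro p hp hpI
    have h := partials_developable_add_sq (p := p)
      ((hξ.contDiffAt (hI.mem_nhds hpI)).differentiableAt (by simp))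
      ((hγ.contDiffAt (hI.mem_nhds hpI)).differentiableAt (by simp))
      ((hB.contDiffAt (hU.mem_nhds hp)).differentiableAt (by simp))
    rwa [← funext hf, hγ' _ hpI] at h
  have hu : ∀ u ∈ Set.Ioo a b, (u, (0 : ℝ)) ∈ U → pd1v f (u, 0) = u • ξ u := by
    intro u hu hU0
    simpa using (hpd (u, 0) hU0 hu).1
  have hv : ∀ u ∈ Set.Ioo a b, (u, (0 : ℝ)) ∈ U → pd2v f (u, 0) = ξ u := by
    intro u hu hU0
    simpa using (hpd (u, 0) hU0 hu).2
  have huv : ∀ u ∈ Set.Ioo a b, (u, (0 : ℝ)) ∈ U →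
      crossProduct (pd1v f (u, 0)) (pd2v f (u, 0)) = 0 := by
    intro u h hU0
    simp [hu u h hU0, hv u h hU0]
  refine ⟨hu, hv, huv, fun h0 => ?_⟩
  -- `f_u - u f_v` is divisible by `v`; `g` is the quotient and `W` the reduced cross product.
  let g : ℝ × ℝ → (Fin 3 → ℝ) := fun p =>
    deriv ξ p.1 + p.2 • pd1v B p - p.1 • ((2 : ℝ) • B p + p.2 • pd2v B p)
  let h : ℝ × ℝ → (Fin 3 → ℝ) := fun p => ξ p.1 + (2 * p.2) • B p + p.2 ^ 2 • pd2v B p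
  let W : ℝ × ℝ → (Fin 3 → ℝ) := fun p => crossProduct (g p) (h p)
  let S : Set (ℝ × ℝ) := U ∩ Prod.fst ⁻¹' Set.Ioo a b
  have hS : IsOpen S := hU.inter (hI.preimage continuous_fst)
  have hmaps : Set.MapsTo Prod.fst S (Set.Ioo a b) := fun p hp => hp.2
  have hξc : ContinuousOn (fun p : ℝ × ℝ => ξ p.1) S :=
    hξ.continuousOn.comp continuousOn_fst hmaps
  have hξ'c : ContinuousOn (fun p : ℝ × ℝ => deriv ξ p.1) S :=
    (hξ.continuousOn_deriv_of_isOpen hI (by simp)).comp continuousOn_fst hmaps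
  have hBc : ContinuousOn B S := hB.continuousOn.mono Set.inter_subset_left
  have hB' : ContinuousOn (fderiv ℝ B) S :=
    (hB.continuousOn_fderiv_of_isOpen hU (by simp)).mono Set.inter_subset_left
  have hB1 : ContinuousOn (pd1v B) S := hB'.clm_apply continuousOn_const
  have hB2 : ContinuousOn (pd2v B) S := hB'.clm_apply continuousOn_const
  have hW : ContinuousOn W S := by
    have hg : ContinuousOn g S := by fun_prop
    have hh : ContinuousOn h S :=
      (hξc.add ((by fun_prop : ContinuousOn (fun p : ℝ × ℝ => 2 * p.2) S).smul hBc)).add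
        ((by fun_prop : ContinuousOn (fun p : ℝ × ℝ => p.2 ^ 2) S).smul hB2)
    exact continuous_crossProduct_uncurry.comp_continuousOn (hg.prodMk hh)
  have hfact : ∀ p ∈ S, crossProduct (pd1v f p) (pd2v f p) = p.2 • W p := by
    intro p hp
    obtain ⟨h1, h2⟩ := hpd p hp.1 hp.2
    have hdecomp : pd1v f p = p.1 • h p + p.2 • g p := by
      rw [h1]
      ext i
      simp only [g, h, Pi.add_apply, Pi.sub_apply, Pi.smul_apply, smul_eq_mul]
      ring
    rw [hdecomp, show pd2v f p = h p from h2]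
    simp [W]
  refine ⟨S ∩ W ⁻¹' {0}ᶜ, hW.isOpen_inter_preimage hS isOpen_compl_singleton,
    ⟨⟨hO, ha, hb⟩, ?_⟩, fun p hp => hp.1.1, fun p hp => hp.1.2, fun p hp => ?_⟩
  · have hW0 : W (0, 0) = -crossProduct (ξ 0) (deriv ξ 0) := by
      rw [cross_anticomm]
      simp [W, g, h]
    exact fun hz => h0 (neg_eq_zero.mp (hW0.symm.trans hz))
  · have hWp : W p ≠ 0 := hp.2
    rw [hfact p hp.1, smul_eq_zero_iff_left hWp]
end

section
/- Let ξ : I → ℝ³ be C^∞ on an open interval I containing 0, let γ : I → ℝ³ satisfy γ'(u) = u·ξ(u), let b : U → ℝ³ be C^∞ on an open neighborhood U of (0,0) ∈ ℝ², and define f(u,v) := γ(u) + v·ξ(u) + v²·b(u,v). Then there exists a C^∞ map ν̃ : V → ℝ³ on a neighborhood V ⊂ U of (0,0) such that (f_u × f_v)(u,v) = v·ν̃(u,v) on V and ν̃(u,0) = ξ'(u) × ξ(u) + 2u·(ξ(u) × b(u,0)) for all u with (u,0) ∈ V. In particular, if ξ(0) × ξ'(0) ≠ 0, then ν̃(0,0)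 = ξ'(0) × ξ(0) ≠ 0, so ν̃ is a nonvanishing normal vector field of f near the origin (f is a frontal near (0,0)). -/
open Matrix

/-- The differential of `γ(u) + v ξ(u) + v² B(u,v)`. -/
theorem fderiv_swallowtail_apply {γ ξ : ℝ → Fin 3 → ℝ} {B : ℝ × ℝ → Fin 3 → ℝ} {p : ℝ × ℝ}
    (hγ : DifferentiableAt ℝ γ p.1) (hξ : DifferentiableAt ℝ ξ p.1)
    (hB : DifferentiableAt ℝ B p) (w : ℝ × ℝ) :
    fderiv ℝ (fun q : ℝ × ℝ => γ q.1 + q.2 • ξ q.1 + q.2 ^ 2 • B q) p w =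
      w.1 • deriv γ p.1 + (p.2 * w.1) • deriv ξ p.1 + w.2 • ξ p.1 + p.2 ^ 2 • fderiv ℝ B p w
        + (2 * p.2 * w.2) • B p := by
  have hfst : HasFDerivAt (fun q : ℝ × ℝ => q.1) (ContinuousLinearMap.fst ℝ ℝ ℝ) p :=
    hasFDerivAt_fst
  have hsnd : HasFDerivAt (fun q : ℝ × ℝ => q.2) (ContinuousLinearMap.snd ℝ ℝ ℝ) p :=
    hasFDerivAt_snd
  have h := ((hγ.hasDerivAt.hasFDerivAt.comp p hfst).add
    (hsnd.smul (hξ.hasDerivAt.hasFDerivAt.comp p hfst))).add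
    ((hsnd.pow 2).smul hB.hasFDerivAt)
  have h' : HasFDerivAt (fun q : ℝ × ℝ => γ q.1 + q.2 • ξ q.1 + q.2 ^ 2 • B q) _ p := h
  rw [h'.fderiv]
  ext i
  simp
  ring

/-- The cross product of smooth maps into `ℝ³` is smooth. -/
theorem ContDiffOn.crossProduct {E : Type*} [NormedAddCommGroup E] [NormedSpace ℝ E]
    {n : WithTop ℕ∞} {s : Set E} {g h : E → Fin 3 → ℝ}
    (hg : ContDiffOn ℝ n g s) (hh : ContDiffOn ℝ n h s) :
    ContDiffOn ℝ n (fun x => _root_.crossProduct (g x) (h x)) s := by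
  rw [contDiffOn_pi] at hg hh ⊢
  intro i
  fin_cases i <;> simp only [cross_apply] <;>
    exact ((hg _).mul (hh _)).sub ((hg _).mul (hh _))

/-- For `f(u,v) = γ(u) + v ξ(u) + v² b(u,v)` with `γ'(u) = u ξ(u)` there is a smooth map
`ν̃` near the origin with `f_u × f_v = v ν̃` and
`ν̃(u,0) = ξ'(u) × ξ(u) + 2u (ξ(u) × b(u,0))`; if moreover `ξ(0) × ξ'(0) ≠ 0` then
`ν̃(0,0) = ξ'(0) × ξ(0) ≠ 0` and `ν̃` is a nonvanishing normal vector field of `f` near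
the origin. -/
theorem stmt6 (a b : ℝ) (ha : a < 0) (hb : 0 < b)
    (U : Set (ℝ × ℝ)) (hU : IsOpen U) (hO : ((0 : ℝ), (0 : ℝ)) ∈ U)
    (ξ γ : ℝ → (Fin 3 → ℝ)) (B : ℝ × ℝ → (Fin 3 → ℝ))
    (hξ : ContDiffOn ℝ (⊤ : ℕ∞) ξ (Set.Ioo a b))
    (hγ : ContDiffOn ℝ (⊤ : ℕ∞) γ (Set.Ioo a b))
    (hγ' : ∀ u ∈ Set.Ioo a b, deriv γ u = u • ξ u)
    (hB : ContDiffOn ℝ (⊤ : ℕ∞) B U)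
    (f : ℝ × ℝ → (Fin 3 → ℝ))
    (hf : ∀ p : ℝ × ℝ, f p = γ p.1 + p.2 • ξ p.1 + p.2 ^ 2 • B p) :
    ∃ V : Set (ℝ × ℝ), ∃ ν : ℝ × ℝ → (Fin 3 → ℝ),
      IsOpen V ∧ ((0 : ℝ), (0 : ℝ)) ∈ V ∧ V ⊆ U ∧
      (∀ p ∈ V, p.1 ∈ Set.Ioo a b) ∧
      ContDiffOn ℝ (⊤ : ℕ∞) ν V ∧
      (∀ p ∈ V, crossProduct (pd1v f p) (pd2v f p) = p.2 • ν p) ∧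
      (∀ u : ℝ, (u, (0 : ℝ)) ∈ V →
        ν (u, 0) = crossProduct (deriv ξ u) (ξ u)
          + (2 * u) • crossProduct (ξ u) (B (u, 0))) ∧
      (crossProduct (ξ 0) (deriv ξ 0) ≠ 0 →
        ν (0, 0) = crossProduct (deriv ξ 0) (ξ 0) ∧ ν (0, 0) ≠ 0 ∧
        ∃ W : Set (ℝ × ℝ), IsOpen W ∧ ((0 : ℝ), (0 : ℝ)) ∈ W ∧ W ⊆ V ∧
          ∀ p ∈ W, ν p ≠ 0 ∧ ν p ⬝ᵥ pd1v f p = 0 ∧ ν p ⬝ᵥ pd2v f p = 0) := by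
  obtain rfl : f = fun p => γ p.1 + p.2 • ξ p.1 + p.2 ^ 2 • B p := funext hf
  clear hf
  set f : ℝ × ℝ → Fin 3 → ℝ := fun p => γ p.1 + p.2 • ξ p.1 + p.2 ^ 2 • B p
  set V : Set (ℝ × ℝ) := U ∩ Prod.fst ⁻¹' Set.Ioo a b
  have hVo : IsOpen V := hU.inter (isOpen_Ioo.preimage continuous_fst)
  have h0V : ((0 : ℝ), (0 : ℝ)) ∈ V := ⟨hO, ha, hb⟩
  let g : ℝ × ℝ → Fin 3 → ℝ := fun p =>
    ξ p.1 + (2 * p.2) • B p + p.2 ^ 2 • pd2v B p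
  let h : ℝ × ℝ → Fin 3 → ℝ := fun p =>
    deriv ξ p.1 + p.2 • pd1v B p - p.1 • ((2 : ℝ) • B p + p.2 • pd2v B p)
  have hd : ∀ p ∈ V, ∀ w, fderiv ℝ f p w =
      w.1 • deriv γ p.1 + (p.2 * w.1) • deriv ξ p.1 + w.2 • ξ p.1 + p.2 ^ 2 • fderiv ℝ B p w
        + (2 * p.2 * w.2) • B p := fun p hp w =>
    fderiv_swallowtail_apply
      ((hγ.contDiffAt (isOpen_Ioo.mem_nhds hp.2)).differentiableAt (by simp))
      ((hξ.contDiffAt (isOpen_Ioo.mem_nhds hp.2)).differentiableAt (by simp))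
      ((hB.contDiffAt (hU.mem_nhds hp.1)).differentiableAt (by simp)) w
  have hfv : ∀ p ∈ V, pd2v f p = g p := by
    intro p hp
    rw [pd2v, hd p hp]
    ext i
    simp [g, pd2v]
    ring
  have hfu : ∀ p ∈ V, pd1v f p = p.1 • g p + p.2 • h p := by
    intro p hp
    rw [pd1v, hd p hp, hγ' p.1 hp.2]
    ext i
    simp [g, h, pd1v, pd2v]
    ring
  have hfst : ContDiffOn ℝ (⊤ : ℕ∞) (Prod.fst : ℝ × ℝ → ℝ) V := contDiff_fst.contDiffOn
  have hsnd : ContDiffOn ℝ (⊤ : ℕ∞) (Prod.snd : ℝ × ℝ → ℝ) V := contDiff_snd.contDiffOn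
  have hBV : ContDiffOn ℝ (⊤ : ℕ∞) B V := hB.mono Set.inter_subset_left
  have hB' : ContDiffOn ℝ (⊤ : ℕ∞) (fderiv ℝ B) V :=
    (hB.fderiv_of_isOpen hU (by simp)).mono Set.inter_subset_left
  have hB1 : ContDiffOn ℝ (⊤ : ℕ∞) (pd1v B) V := hB'.clm_apply contDiffOn_const
  have hB2 : ContDiffOn ℝ (⊤ : ℕ∞) (pd2v B) V := hB'.clm_apply contDiffOn_const
  have hξV : ContDiffOn ℝ (⊤ : ℕ∞) (fun p : ℝ × ℝ => ξ p.1) V :=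
    hξ.comp hfst fun p hp => hp.2
  have hξ'V : ContDiffOn ℝ (⊤ : ℕ∞) (fun p : ℝ × ℝ => deriv ξ p.1) V :=
    (hξ.deriv_of_isOpen isOpen_Ioo (by simp)).comp hfst fun p hp => hp.2
  have hg : ContDiffOn ℝ (⊤ : ℕ∞) g V :=
    (hξV.add ((contDiffOn_const.mul hsnd).smul hBV)).add ((hsnd.pow 2).smul hB2)
  have hh : ContDiffOn ℝ (⊤ : ℕ∞) h V :=
    (hξ'V.add (hsnd.smul hB1)).sub
      (hfst.smul ((hBV.const_smul (2 : ℝ)).add (hsnd.smul hB2)))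
  have hν : ContDiffOn ℝ (⊤ : ℕ∞) (fun p => crossProduct (h p) (g p)) V := hh.crossProduct hg
  have hν0 : ∀ u : ℝ, crossProduct (h (u, 0)) (g (u, 0)) = crossProduct (deriv ξ u) (ξ u)
      + (2 * u) • crossProduct (ξ u) (B (u, 0)) := by
    intro u
    simp only [g, h, ← cross_anticomm (B (u, 0)) (ξ u)]
    ext i
    simp only [zero_smul, mul_zero, add_zero, map_sub, map_smul, LinearMap.sub_apply,
      LinearMap.smul_apply, Pi.sub_apply, Pi.add_apply, Pi.smul_apply, Pi.neg_apply, smul_eq_mul,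
      ne_eq, OfNat.ofNat_ne_zero, not_false_eq_true, zero_pow]
    ring
  refine ⟨V, fun p => crossProduct (h p) (g p), hVo, h0V, Set.inter_subset_left,
    fun p hp => hp.2, hν, fun p hp => ?_, fun u _ => hν0 u, fun hne => ?_⟩
  · rw [hfu p hp, hfv p hp]
    simp
  · have h00 : crossProduct (h (0, 0)) (g (0, 0)) = crossProduct (deriv ξ 0) (ξ 0) := by
      simpa using hν0 0
    have hne' : crossProduct (h (0, 0)) (g (0, 0)) ≠ 0 := by
      rw [h00, ← cross_anticomm]
      exact neg_ne_zero.mpr hne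
    refine ⟨h00, hne', V ∩ (fun p => crossProduct (h p) (g p)) ⁻¹' {0}ᶜ,
      hν.continuousOn.isOpen_inter_preimage hVo isOpen_compl_singleton, ⟨h0V, hne'⟩,
      Set.inter_subset_left, fun p hp => ⟨hp.2, ?_, ?_⟩⟩
    · rw [hfu p hp.1, dotProduct_add, dotProduct_smul, dotProduct_smul,
        dotProduct_comm _ (g p), dotProduct_comm _ (h p)]
      simp
    · rw [hfv p hp.1, dotProduct_comm]
      simp
end

section
/- Let ξ : I → ℝ³ be C^∞ on an open interval I containing 0, and let b : U → ℝ³ be C^∞ on a neighborhood U of (0,0) ∈ ℝ². Define ν̃₀(u) := ξ'(u) × ξ(u) + 2u·(ξ(u) × b(u,0)). Then ⟨ν̃₀'(0), ν̃₀(0) × ξ(0)⟩ = ‖ξ(0)‖² · det(ξ(0), ξ'(0), −ξ''(0) + 2·b(0,0)). -/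
open Matrix

/-- `det3 x y z` is the determinant of the 3×3 matrix with columns `x, y, z`
(the scalar triple product). -/
noncomputable def det3 (x y z : Fin 3 → ℝ) : ℝ :=
  Matrix.det (Matrix.transpose (Matrix.of ![x, y, z]))

theorem hasDerivAt_crossProduct {f g : ℝ → Fin 3 → ℝ} {f' g' : Fin 3 → ℝ} {x : ℝ}
    (hf : HasDerivAt f f' x) (hg : HasDerivAt g g' x) :
    HasDerivAt (fun u => crossProduct (f u) (g u))
      (crossProduct f' (g x) + crossProduct (f x) g') x := by
  rw [hasDerivAt_pi] at hf hg ⊢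
  intro i
  fin_cases i
  · refine (((hf 1).mul (hg 2)).sub ((hf 2).mul (hg 1))).congr_deriv ?_
    simp [cross_apply]
    ring
  · refine (((hf 2).mul (hg 0)).sub ((hf 0).mul (hg 2))).congr_deriv ?_
    simp [cross_apply]
    ring
  · refine (((hf 0).mul (hg 1)).sub ((hf 1).mul (hg 0))).congr_deriv ?_
    simp [cross_apply]
    ring

/-- For `ν̃₀(u) = ξ'(u) × ξ(u) + 2u (ξ(u) × b(u,0))` one has
`⟨ν̃₀'(0), ν̃₀(0) × ξ(0)⟩ = ‖ξ(0)‖² det(ξ(0), ξ'(0), -ξ''(0) + 2 b(0,0))`. -/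
theorem stmt7 (a b : ℝ) (ha : a < 0) (hb : 0 < b)
    (U : Set (ℝ × ℝ)) (hU : IsOpen U) (hO : ((0 : ℝ), (0 : ℝ)) ∈ U)
    (ξ : ℝ → (Fin 3 → ℝ)) (B : ℝ × ℝ → (Fin 3 → ℝ))
    (hξ : ContDiffOn ℝ (⊤ : ℕ∞) ξ (Set.Ioo a b))
    (hB : ContDiffOn ℝ (⊤ : ℕ∞) B U)
    (ν₀ : ℝ → (Fin 3 → ℝ))
    (hν₀ : ∀ u : ℝ, ν₀ u = crossProduct (deriv ξ u) (ξ u)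
      + (2 * u) • crossProduct (ξ u) (B (u, 0))) :
    deriv ν₀ 0 ⬝ᵥ crossProduct (ν₀ 0) (ξ 0) =
      (ξ 0 ⬝ᵥ ξ 0) *
        det3 (ξ 0) (deriv ξ 0) (-(deriv (deriv ξ) 0) + (2 : ℝ) • B (0, 0)) := by
  have hmem : (0 : ℝ) ∈ Set.Ioo a b := ⟨ha, hb⟩
  have hξ' : HasDerivAt ξ (deriv ξ 0) 0 :=
    ((hξ.contDiffAt (isOpen_Ioo.mem_nhds hmem)).differentiableAt (by simp)).hasDerivAt
  have hξ'' : HasDerivAt (deriv ξ) (deriv (deriv ξ) 0) 0 :=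
    (((hξ.deriv_of_isOpen (m := 1) isOpen_Ioo (WithTop.coe_le_coe.2 le_top)).contDiffAt
      (isOpen_Ioo.mem_nhds hmem)).differentiableAt (by simp)).hasDerivAt
  have hB' : HasDerivAt (fun u : ℝ => B (u, 0)) (deriv (fun u : ℝ => B (u, 0)) 0) 0 := by
    have h : DifferentiableAt ℝ B (0, 0) :=
      (hB.contDiffAt (hU.mem_nhds hO)).differentiableAt (by simp)
    have hline : DifferentiableAt ℝ (fun u : ℝ => (u, (0 : ℝ))) 0 := by fun_prop
    exact (DifferentiableAt.comp (f := fun u : ℝ => (u, (0 : ℝ))) (0 : ℝ) h hline).hasDerivAt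
  have hν : deriv ν₀ 0 = crossProduct (deriv (deriv ξ) 0) (ξ 0)
      + (2 : ℝ) • crossProduct (ξ 0) (B (0, 0)) := by
    rw [funext hν₀]
    have h2 : HasDerivAt (fun u : ℝ => 2 * u) 2 0 := by
      simpa using (hasDerivAt_id (0 : ℝ)).const_mul 2
    refine ((hasDerivAt_crossProduct hξ'' hξ').add
      (h2.smul (hasDerivAt_crossProduct hξ' hB'))).deriv.trans ?_
    simp
  rw [hν, hν₀ 0]
  simp [det3, cross_apply, Matrix.det_fin_three, dotProduct, Fin.sum_univ_three]
  ring
end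

section
/- The map f : ℝ² → ℝ³ defined by f(u,v) := (u² + 2v, u³ + 3uv, 2uv²) is injective. -/
/-- The map `f(u,v) = (u² + 2v, u³ + 3uv, 2uv²)` (a non-generic generalized swallowtail
along the space-cusp `(u², u³, 0)`) is injective: the surface has no self-intersections. -/
theorem stmt11 (f : ℝ × ℝ → (Fin 3 → ℝ))
    (hf : ∀ p : ℝ × ℝ,
      f p = ![p.1 ^ 2 + 2 * p.2, p.1 ^ 3 + 3 * p.1 * p.2, 2 * p.1 * p.2 ^ 2]) :
    Function.Injective f := by
  rintro ⟨u, v⟩ ⟨x, y⟩ h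
  rw [hf, hf] at h
  have h₀ : u ^ 2 + 2 * v = x ^ 2 + 2 * y := by simpa using congrFun h 0
  have h₁ : u ^ 3 + 3 * u * v = x ^ 3 + 3 * x * y := by simpa using congrFun h 1
  have h₂ : 2 * u * v ^ 2 = 2 * x * y ^ 2 := by simpa using congrFun h 2
  have hux : u = x := by
    by_contra hne
    have hd : u - x ≠ 0 := sub_ne_zero.mpr hne
    have hy : y = (u ^ 2 + 2 * v - x ^ 2) / 2 := by linarith
    subst hy
    have hs : 3 * (u ^ 2 + 2 * v) = u ^ 2 + u * x + x ^ 2 := by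
      apply mul_left_cancel₀ hd
      linear_combination 2 * h₁
    have hv : v = (x ^ 2 + u * x - 2 * u ^ 2) / 6 := by linarith
    subst hv
    have hq : 4 * u ^ 2 + 7 * u * x + 4 * x ^ 2 = 0 := by
      apply mul_left_cancel₀ (pow_ne_zero 3 hd)
      linear_combination 18 * h₂
    have hsq : u ^ 2 + x ^ 2 ≤ 0 := by nlinarith [sq_nonneg (u + x)]
    have hu : u = 0 := by nlinarith [sq_nonneg u, sq_nonneg x]
    have hx : x = 0 := by nlinarith [sq_nonneg u, sq_nonneg x]
    exact hne (hu.trans hx.symm)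
  subst hux
  exact Prod.ext rfl (by linarith)
end

section
/- Let ξ : I → ℝ³ and q : I → ℝ be C^∞ on an open interval I containing 0, let γ satisfy γ'(u) = u·ξ(u), let r : U → ℝ³ be C^∞ on a neighborhood U of (0,0) ∈ ℝ², and define f(u,v) := γ(u) + v·ξ(u) + v²·q(u)·ξ'(u) + v³·r(u,v). Then (f_u × f_v)(u,0) = 0 for all u, and ∂/∂v|_{v=0} (f_u × f_v)(u,v) = (2u·q(u) − 1)·(ξ(u) × ξ'(u)). -/
theorem HasDerivAt.crossProduct {A B : ℝ → Fin 3 → ℝ} {A' B' : Fin 3 → ℝ} {t : ℝ}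
    (hA : HasDerivAt A A' t) (hB : HasDerivAt B B' t) :
    HasDerivAt (fun s => crossProduct (A s) (B s))
      (crossProduct (A t) B' + crossProduct A' (B t)) t := by
  rw [hasDerivAt_pi] at hA hB ⊢
  intro i
  fin_cases i
  · refine (((hA 1).mul (hB 2)).sub ((hA 2).mul (hB 1))).congr_deriv ?_
    simp [cross_apply]
    ring
  · refine (((hA 2).mul (hB 0)).sub ((hA 0).mul (hB 2))).congr_deriv ?_
    simp [cross_apply]
    ring
  · refine (((hA 0).mul (hB 1)).sub ((hA 1).mul (hB 0))).congr_deriv ?_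
    simp [cross_apply]
    ring

theorem hasDerivAt_zero_of_quadratic_remainder {E : Type*} [NormedAddCommGroup E]
    [NormedSpace ℝ E] (x y : E) {g : ℝ → E} (hg : DifferentiableAt ℝ g 0) :
    HasDerivAt (fun v : ℝ => x + v • y + v ^ 2 • g v) y 0 := by
  have hlin := (hasDerivAt_id (0 : ℝ)).smul_const y
  have hquad := ((hasDerivAt_id (0 : ℝ)).pow 2).smul hg.hasDerivAt
  exact ((hlin.const_add x).add hquad).congr_deriv (by simp)

/-- The two partial derivatives of `γ(u) + v ξ(u) + v² q(u) η(u) + v³ r(u,v)`. -/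
theorem partials_swallowtail {ξ γ η : ℝ → Fin 3 → ℝ} {q : ℝ → ℝ} {r f : ℝ × ℝ → Fin 3 → ℝ}
    (hf : ∀ p : ℝ × ℝ,
      f p = γ p.1 + p.2 • ξ p.1 + (p.2 ^ 2 * q p.1) • η p.1 + p.2 ^ 3 • r p)
    {p : ℝ × ℝ} (hγ : DifferentiableAt ℝ γ p.1) (hξ : DifferentiableAt ℝ ξ p.1)
    (hη : DifferentiableAt ℝ η p.1) (hq : DifferentiableAt ℝ q p.1)
    (hr : DifferentiableAt ℝ r p) :
    pd1v f p = deriv γ p.1 + p.2 • deriv ξ p.1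
        + p.2 ^ 2 • (deriv q p.1 • η p.1 + q p.1 • deriv η p.1 + p.2 • pd1v r p) ∧
      pd2v f p = ξ p.1 + p.2 • ((2 * q p.1) • η p.1)
        + p.2 ^ 2 • ((3 : ℝ) • r p + p.2 • pd2v r p) := by
  have hfst : HasFDerivAt (Prod.fst : ℝ × ℝ → ℝ) (ContinuousLinearMap.fst ℝ ℝ ℝ) p :=
    hasFDerivAt_fst
  have hsnd : HasFDerivAt (Prod.snd : ℝ × ℝ → ℝ) (ContinuousLinearMap.snd ℝ ℝ ℝ) p :=
    hasFDerivAt_snd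
  have h := (((hγ.hasDerivAt.hasFDerivAt.comp p hfst).add
    (hsnd.smul (hξ.hasDerivAt.hasFDerivAt.comp p hfst))).add
    (((hsnd.pow 2).mul (hq.hasDerivAt.hasFDerivAt.comp p hfst)).smul
      (hη.hasDerivAt.hasFDerivAt.comp p hfst))).add
    ((hsnd.pow 3).smul hr.hasFDerivAt)
  have hf' := (h.congr_of_eventuallyEq (f₁ := f) (.of_forall hf)).fderiv
  constructor
  · rw [pd1v, hf']
    ext i
    simp [pd1v]
    ring
  · rw [pd2v, hf']
    ext i
    simp [pd2v]
    ring

/-- For `f(u,v) = γ(u) + v ξ(u) + v² q(u) ξ'(u) + v³ r(u,v)` with `γ'(u) = u ξ(u)`: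
`(f_u × f_v)(u,0) = 0` and
`∂/∂v |_{v=0} (f_u × f_v)(u,v) = (2u q(u) - 1) (ξ(u) × ξ'(u))`. -/
theorem stmt13 (a b : ℝ) (ha : a < 0) (hb : 0 < b)
    (U : Set (ℝ × ℝ)) (hU : IsOpen U) (hO : ((0 : ℝ), (0 : ℝ)) ∈ U)
    (ξ γ : ℝ → (Fin 3 → ℝ)) (q : ℝ → ℝ) (r : ℝ × ℝ → (Fin 3 → ℝ))
    (hξ : ContDiffOn ℝ (⊤ : ℕ∞) ξ (Set.Ioo a b))
    (hγ : ContDiffOn ℝ (⊤ : ℕ∞) γ (Set.Ioo a b))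
    (hq : ContDiffOn ℝ (⊤ : ℕ∞) q (Set.Ioo a b))
    (hγ' : ∀ u ∈ Set.Ioo a b, deriv γ u = u • ξ u)
    (hr : ContDiffOn ℝ (⊤ : ℕ∞) r U)
    (f : ℝ × ℝ → (Fin 3 → ℝ))
    (hf : ∀ p : ℝ × ℝ,
      f p = γ p.1 + p.2 • ξ p.1 + (p.2 ^ 2 * q p.1) • deriv ξ p.1 + p.2 ^ 3 • r p) :
    ∀ u ∈ Set.Ioo a b, (u, (0 : ℝ)) ∈ U →
      crossProduct (pd1v f (u, 0)) (pd2v f (u, 0)) = 0 ∧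
      deriv (fun v : ℝ => crossProduct (pd1v f (u, v)) (pd2v f (u, v))) 0
        = (2 * u * q u - 1) • crossProduct (ξ u) (deriv ξ u) := by
  intro u hu huU
  have hI : ∀ {x}, x ∈ Set.Ioo a b → Set.Ioo a b ∈ nhds x := isOpen_Ioo.mem_nhds
  have hξu := hξ.contDiffAt (hI hu)
  have hη : DifferentiableAt ℝ (deriv ξ) u :=
    ((hξ.deriv_of_isOpen (m := 1) isOpen_Ioo (WithTop.coe_le_coe.2 le_top)).contDiffAt
      (hI hu)).differentiableAt (by simp)
  have hpart : ∀ v, (u, v) ∈ U → _ := fun v hv =>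
    partials_swallowtail hf (p := (u, v)) ((hγ.contDiffAt (hI hu)).differentiableAt (by simp))
      (hξu.differentiableAt (by simp)) hη ((hq.contDiffAt (hI hu)).differentiableAt (by simp))
      ((hr.contDiffAt (hU.mem_nhds hv)).differentiableAt (by simp))
  have hru := hr.contDiffAt (hU.mem_nhds huU)
  have hline : DifferentiableAt ℝ (fun v : ℝ => (u, v)) 0 := by fun_prop
  have hr0 : DifferentiableAt ℝ (fun v => r (u, v)) 0 :=
    DifferentiableAt.comp (g := r) (0 : ℝ) (hru.differentiableAt (by simp)) hline
  have hdr : DifferentiableAt ℝ (fun v => fderiv ℝ r (u, v)) 0 :=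
    DifferentiableAt.comp (g := fderiv ℝ r) (0 : ℝ)
      ((hru.fderiv_right (m := 1) (WithTop.coe_le_coe.2 le_top)).differentiableAt (by simp)) hline
  have hU0 : ∀ᶠ v in nhds (0 : ℝ), (u, v) ∈ U :=
    hline.continuousAt.eventually_mem (hU.mem_nhds huU)
  have hA : HasDerivAt (fun v => pd1v f (u, v)) (deriv ξ u) 0 :=
    (hasDerivAt_zero_of_quadratic_remainder (deriv γ u) _
      (g := fun v => deriv q u • deriv ξ u + q u • deriv (deriv ξ) u + v • pd1v r (u, v))
      ((differentiableAt_const _).add (differentiableAt_id.smul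
        (hdr.clm_apply (differentiableAt_const _))))).congr_of_eventuallyEq
      (hU0.mono fun v hv => (hpart v hv).1)
  have hB : HasDerivAt (fun v => pd2v f (u, v)) ((2 * q u) • deriv ξ u) 0 :=
    (hasDerivAt_zero_of_quadratic_remainder (ξ u) _
      (g := fun v => (3 : ℝ) • r (u, v) + v • pd2v r (u, v))
      ((hr0.const_smul (3 : ℝ)).add (differentiableAt_id.smul
        (hdr.clm_apply (differentiableAt_const _))))).congr_of_eventuallyEq
      (hU0.mono fun v hv => (hpart v hv).2)
  have hA0 : pd1v f (u, 0) = u • ξ u := by simpa [hγ' u hu] using (hpart 0 huU).1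
  have hB0 : pd2v f (u, 0) = ξ u := by simpa using (hpart 0 huU).2
  refine ⟨by simp [hA0, hB0], ?_⟩
  rw [(hA.crossProduct hB).deriv, hA0, hB0, ← cross_anticomm (ξ u)]
  simp only [map_smul, LinearMap.smul_apply, smul_smul]
  module
end

section
/- Let U ⊂ ℝ² be an open neighborhood of a segment of the u-axis, f : U → ℝ³ a C^∞ map, ε : U → ℝ and ψ : U → ℝ³ C^∞ maps such that f_u(u,v) + ε(u,v)·f_v(u,v) = v·ψ(u,v) on U. Define ν̃(u) := ψ(u,0) × f_v(u,0). Then for every u with (u,0) ∈ U, ⟨f_uu(u,0), ν̃(u)⟩ = ε(u,0)² · ⟨f_vv(u,0), ν̃(u)⟩. -/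
open Matrix

/-- Partial derivatives of a `C²` map commute. -/
lemma pd1v_pd2v_comm {F : ℝ × ℝ → (Fin 3 → ℝ)} {p : ℝ × ℝ} (hF : ContDiffAt ℝ 2 F p) :
    pd1v (pd2v F) p = pd2v (pd1v F) p := by
  have hd : DifferentiableAt ℝ (fderiv ℝ F) p :=
    (hF.fderiv_right (m := 1) (by norm_num)).differentiableAt (by norm_num)
  have hs : IsSymmSndFDerivAt ℝ F p := hF.isSymmSndFDerivAt (by simp)
  have key (a b : ℝ × ℝ) :
      fderiv ℝ (fun q => fderiv ℝ F q a) p b = fderiv ℝ (fderiv ℝ F) p b a := by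
    rw [fderiv_clm_apply hd (differentiableAt_const a)]
    simp
  change fderiv ℝ (fun q => fderiv ℝ F q (0, 1)) p (1, 0)
    = fderiv ℝ (fun q => fderiv ℝ F q (1, 0)) p (0, 1)
  rw [key, key]
  exact hs _ _

/-- Differentiating the relation `A + ε B = v ψ` at a point in the direction `w`. -/
lemma fderiv_apply_of_add_smul_eventuallyEq
    {A B ψ : ℝ × ℝ → (Fin 3 → ℝ)} {ε : ℝ × ℝ → ℝ} {p : ℝ × ℝ}
    (hA : DifferentiableAt ℝ A p) (hB : DifferentiableAt ℝ B p)
    (hψ : DifferentiableAt ℝ ψ p) (hε : DifferentiableAt ℝ ε p)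
    (h : (fun q => A q + ε q • B q) =ᶠ[nhds p] fun q => q.2 • ψ q) (w : ℝ × ℝ) :
    fderiv ℝ A p w + (ε p • fderiv ℝ B p w + fderiv ℝ ε p w • B p)
      = p.2 • fderiv ℝ ψ p w + w.2 • ψ p := by
  have hl := hA.hasFDerivAt.add (hε.hasFDerivAt.smul hB.hasFDerivAt)
  have hr := (hasFDerivAt_snd (𝕜 := ℝ) (p := p)).smul hψ.hasFDerivAt
  have he := (hl.congr_of_eventuallyEq h.symm).unique hr
  simpa using DFunLike.congr_fun he w

/-- Euclidean form of Proposition A.2: if `f_u + ε f_v = v ψ` on an open set `U`, then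
along the `u`-axis, with `ν̃(u) := ψ(u,0) × f_v(u,0)`,
`⟨f_uu(u,0), ν̃(u)⟩ = ε(u,0)² ⟨f_vv(u,0), ν̃(u)⟩`. -/
theorem stmt17 (U : Set (ℝ × ℝ)) (hU : IsOpen U)
    (f : ℝ × ℝ → (Fin 3 → ℝ)) (ε : ℝ × ℝ → ℝ) (ψ : ℝ × ℝ → (Fin 3 → ℝ))
    (hf : ContDiffOn ℝ (⊤ : ℕ∞) f U)
    (hε : ContDiffOn ℝ (⊤ : ℕ∞) ε U)
    (hψ : ContDiffOn ℝ (⊤ : ℕ∞) ψ U)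
    (hnull : ∀ p ∈ U, pd1v f p + ε p • pd2v f p = p.2 • ψ p) :
    ∀ u : ℝ, (u, (0 : ℝ)) ∈ U →
      pd1v (fun p => pd1v f p) (u, 0) ⬝ᵥ crossProduct (ψ (u, 0)) (pd2v f (u, 0))
        = (ε (u, 0)) ^ 2 *
          (pd2v (fun p => pd2v f p) (u, 0) ⬝ᵥ
            crossProduct (ψ (u, 0)) (pd2v f (u, 0))) := by
  intro u hu
  have hn : U ∈ nhds (u, (0 : ℝ)) := hU.mem_nhds hu
  have hf2 : ContDiffAt ℝ 2 f (u, 0) :=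
    (hf.contDiffAt hn).of_le (by exact WithTop.coe_le_coe.2 le_top)
  have hd : DifferentiableAt ℝ (fderiv ℝ f) (u, 0) :=
    (hf2.fderiv_right (m := 1) (by norm_num)).differentiableAt (by norm_num)
  have hw := fderiv_apply_of_add_smul_eventuallyEq
    (A := pd1v f) (B := pd2v f) (hd.clm_apply (differentiableAt_const _))
    (hd.clm_apply (differentiableAt_const _))
    ((hψ.contDiffAt hn).differentiableAt (by simp))
    ((hε.contDiffAt hn).differentiableAt (by simp))
    (Filter.eventually_of_mem hn hnull)
  have h1 := congrArg (· ⬝ᵥ crossProduct (ψ (u, 0)) (pd2v f (u, 0))) (hw (1, 0))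
  have h2 := congrArg (· ⬝ᵥ crossProduct (ψ (u, 0)) (pd2v f (u, 0))) (hw (0, 1))
  have hc := pd1v_pd2v_comm hf2
  change fderiv ℝ (pd2v f) (u, 0) (1, 0) = fderiv ℝ (pd1v f) (u, 0) (0, 1) at hc
  simp only [add_dotProduct, smul_dotProduct, dot_self_cross, dot_cross_self, smul_eq_mul,
    mul_zero, zero_mul, add_zero, hc] at h1 h2
  change fderiv ℝ (pd1v f) (u, 0) (1, 0) ⬝ᵥ _
    = _ * (fderiv ℝ (pd2v f) (u, 0) (0, 1) ⬝ᵥ _)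
  linear_combination h1 - ε (u, 0) * h2
end
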